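/- Let M be a positive integer, p_u, p_d, β_h, β_g, α_h, α_g, γ_h > 0 and γ_g ≥ 0, with β_h ≤ β_g and α_h·β_h ≤ α_g·β_g. Set D = p_u·α_h·β_h + p_u·α_g·β_g + 1, λ_h = p_u·α_h·β_h/D, λ_g = p_u·α_g·β_g/D. Then the effective SINR of the cell-edge user's symbol at the cell-edge user is at most its effective SINR at the cell-center user: p_d·λ_h·β_h·γ_h·M/(p_d·λ_h·β_h·γ_g·M + p_d·β_h + 1) ≤ p_d·λ_g·β_g·γ_h·M/(p_d·λ_g·β_g·γ_g·M + p_d·β_g + 1). Consequently the cell-center user can decode and cancel the cell-edge user's data. (SINR ordering inequality, equation (42); the condition β_h ≤ β_g holds in the paper's scenario of cell-edge versus cell-center users.) -/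

import Mathlib

/-- SINR ordering inequality, equation (42): under `β_h ≤ β_g` and
`α_h·β_h ≤ α_g·β_g`, the effective SINR of the cell-edge user's symbol at the
cell-edge user is at most its effective SINR at the cell-center user, so the
cell-center user can decode and cancel the cell-edge user's data. -/
theorem stmt15
    {M : ℕ} (hM : 0 < M)
    {pu pd βh βg αh αg γh γg : ℝ}
    (hpu : 0 < pu) (hpd : 0 < pd) (hβh : 0 < βh) (hβg : 0 < βg)
    (hαh : 0 < αh) (hαg : 0 < αg) (hγh : 0 < γh) (hγg : 0 ≤ γg)
    (hββ : βh ≤ βg) (hαβ : αh * βh ≤ αg * βg)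
    {D lamh lamg : ℝ}
    (hD : D = pu * αh * βh + pu * αg * βg + 1)
    (hlamh : lamh = pu * αh * βh / D)
    (hlamg : lamg = pu * αg * βg / D) :
    pd * lamh * βh * γh * M / (pd * lamh * βh * γg * M + pd * βh + 1)
      ≤ pd * lamg * βg * γh * M / (pd * lamg * βg * γg * M + pd * βg + 1) := by
  have hDpos : 0 < D := by rw [hD]; positivity
  have hh : 0 < lamh := by rw [hlamh]; positivity
  have hg : 0 < lamg := by rw [hlamg]; positivity
  have hle : lamh ≤ lamg := by
    rw [hlamh, hlamg, mul_assoc, mul_assoc]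
    gcongr
  have hle' : lamh * βh ≤ lamg * βg := by gcongr
  have hdiff : 0 ≤ pd * γh * M *
      (pd * βh * βg * (lamg - lamh) + (lamg * βg - lamh * βh)) :=
    mul_nonneg (by positivity)
      (add_nonneg (mul_nonneg (by positivity) (sub_nonneg.2 hle)) (sub_nonneg.2 hle'))
  rw [div_le_div_iff₀ (by positivity) (by positivity)]
  linarith
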